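/- Let D be a p×p diagonal matrix with positive diagonal entries and D_min := min_i D(i,i). Let R and R' be real p×p matrices with |R'(i,j)| ≤ |R(i,j)| for all i,j and α := ‖R̄‖ < 1, where R̄ is the entrywise absolute value of R. Define the precision matrices J = D^{1/2}(I−R)D^{1/2} and J' = D^{1/2}(I−R')D^{1/2}. Fix indices i,j and γ ∈ ℕ such that (R^k)(i,j) = ((R')^k)(i,j) for all 0 ≤ k ≤ γ. Then J and J' are invertible and |(J^{-1})(i,j) − ((J')^{-1})(i,j)| ≤ (α^γ / D_min) · 2α/(1−α). -/

import Mathlib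

/-- The spectral norm (operator 2-norm) of a real matrix, viewed as a linear map
between Euclidean spaces. -/
noncomputable def spec {m n : Type*} [Fintype m] [Fintype n] [DecidableEq n]
    (A : Matrix m n ℝ) : ℝ :=
  ‖LinearMap.toContinuousLinearMap
    ((Matrix.toLin (PiLp.basisFun 2 ℝ n) (PiLp.basisFun 2 ℝ m)) A)‖

theorem abs_pow_apply_le {n : Type*} [Fintype n] [DecidableEq n]
    {A B : Matrix n n ℝ} (h : ∀ i j, |A i j| ≤ B i j) (k : ℕ) (i j : n) :
    |(A ^ k) i j| ≤ (B ^ k) i j := by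
  induction k generalizing i j with
  | zero =>
    simp only [pow_zero, Matrix.one_apply]
    split_ifs <;> simp
  | succ k ih =>
    rw [pow_succ, pow_succ, Matrix.mul_apply, Matrix.mul_apply]
    refine (Finset.abs_sum_le_sum_abs _ _).trans (Finset.sum_le_sum fun l _ => ?_)
    rw [abs_mul]
    exact mul_le_mul (ih i l) (h l j) (abs_nonneg _) ((abs_nonneg _).trans (ih i l))

theorem spec_nonneg {m n : Type*} [Fintype m] [Fintype n] [DecidableEq n]
    (A : Matrix m n ℝ) : 0 ≤ spec A :=
  norm_nonneg _

open scoped Matrix.Norms.L2Operator in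
theorem spec_eq_l2_opNorm {m n : Type*} [Fintype m] [Fintype n] [DecidableEq n]
    (A : Matrix m n ℝ) : spec A = ‖A‖ :=
  rfl

open scoped Matrix.Norms.L2Operator in
theorem abs_apply_le_spec {m n : Type*} [Fintype m] [Fintype n] [DecidableEq n]
    (A : Matrix m n ℝ) (i : m) (j : n) : |A i j| ≤ spec A := by
  rw [spec_eq_l2_opNorm]
  simpa using (PiLp.norm_apply_le _ i).trans
    (Matrix.l2_opNorm_mulVec A (EuclideanSpace.single j (1 : ℝ)))

open scoped Matrix.Norms.L2Operator in
theorem spec_pow_le {n : Type*} [Fintype n] [DecidableEq n] (A : Matrix n n ℝ)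
    {k : ℕ} (hk : 0 < k) : spec (A ^ k) ≤ spec A ^ k := by
  rw [spec_eq_l2_opNorm, spec_eq_l2_opNorm]
  exact norm_pow_le' A hk

/-- Entries of powers of a matrix dominated entrywise by `B` decay like powers of `spec B`. -/
theorem abs_pow_apply_le_spec_pow {n : Type*} [Fintype n] [DecidableEq n]
    {A B : Matrix n n ℝ} (h : ∀ i j, |A i j| ≤ B i j) (k : ℕ) (i j : n) :
    |(A ^ k) i j| ≤ spec B ^ k := by
  rcases Nat.eq_zero_or_pos k with rfl | hk
  · simp only [pow_zero, Matrix.one_apply]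
    split_ifs <;> simp
  · exact (abs_pow_apply_le h k i j).trans <| (le_abs_self _).trans <|
      (abs_apply_le_spec _ i j).trans (spec_pow_le B hk)

theorem summable_pow_of_abs_le {n : Type*} [Fintype n] [DecidableEq n]
    {A B : Matrix n n ℝ} (h : ∀ i j, |A i j| ≤ B i j) (hB : spec B < 1) :
    Summable fun k : ℕ => A ^ k := by
  refine Pi.summable.2 fun i => Pi.summable.2 fun j => ?_
  exact Summable.of_norm_bounded (summable_geometric_of_lt_one (spec_nonneg B) hB)
    fun k => abs_pow_apply_le_spec_pow h k i j

theorem diagonal_mul_mul_diagonal_inv {n K : Type*} [Fintype n] [DecidableEq n] [Field K]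
    {s : n → K} (hs : ∀ a, s a ≠ 0) {M S : Matrix n n K} (h : M * S = 1) :
    IsUnit (Matrix.diagonal s * M * Matrix.diagonal s) ∧
      ∀ i j, (Matrix.diagonal s * M * Matrix.diagonal s)⁻¹ i j = (s i)⁻¹ * S i j * (s j)⁻¹ := by
  have h1 : Matrix.diagonal s * Matrix.diagonal (fun a => (s a)⁻¹) = 1 := by
    rw [Matrix.diagonal_mul_diagonal]
    simp [hs]
  have key : Matrix.diagonal s * M * Matrix.diagonal s *
      (Matrix.diagonal (fun a => (s a)⁻¹) * S * Matrix.diagonal (fun a => (s a)⁻¹)) = 1 := by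
    calc _ = Matrix.diagonal s * (M * ((Matrix.diagonal s * Matrix.diagonal (fun a => (s a)⁻¹)) *
            S)) * Matrix.diagonal (fun a => (s a)⁻¹) := by simp only [Matrix.mul_assoc]
      _ = 1 := by rw [h1, Matrix.one_mul, h, Matrix.mul_one, h1]
  refine ⟨IsUnit.of_mul_eq_one _ key, fun i j => ?_⟩
  rw [Matrix.inv_eq_right_inv key, Matrix.mul_diagonal, Matrix.diagonal_mul]

/-- Two geometrically bounded sequences agreeing up to index `γ` have close sums. -/
theorem abs_tsum_sub_tsum_le {f g : ℕ → ℝ} {α : ℝ} (h0 : 0 ≤ α) (h1 : α < 1)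
    (hf : ∀ k, |f k| ≤ α ^ k) (hg : ∀ k, |g k| ≤ α ^ k) {γ : ℕ} (hfg : ∀ k ≤ γ, f k = g k) :
    |∑' k, f k - ∑' k, g k| ≤ α ^ γ * (2 * α / (1 - α)) := by
  have hgeo := summable_geometric_of_lt_one h0 h1
  have hsf : Summable f := Summable.of_norm_bounded hgeo hf
  have hsg : Summable g := Summable.of_norm_bounded hgeo hg
  rw [← hsf.tsum_sub hsg, ← (hsf.sub hsg).sum_add_tsum_nat_add (γ + 1),
    Finset.sum_eq_zero fun k hk => sub_eq_zero.2 (hfg k (by simp at hk; omega)), zero_add]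
  have hs : HasSum (fun k : ℕ => 2 * α ^ (γ + 1) * α ^ k) (2 * α ^ (γ + 1) * (1 - α)⁻¹) :=
    (hasSum_geometric_of_lt_one h0 h1).mul_left _
  have hb := tsum_of_norm_bounded (f := fun k => f (k + (γ + 1)) - g (k + (γ + 1))) hs fun k => by
    have h2 : α ^ (k + (γ + 1)) = α ^ (γ + 1) * α ^ k := by ring
    rw [Real.norm_eq_abs]
    linarith [abs_sub (f (k + (γ + 1))) (g (k + (γ + 1))), hf (k + (γ + 1)), hg (k + (γ + 1))]
  refine hb.trans_eq ?_
  ring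

/-- **Covariance bound for general (unnormalized) walk-summable precision matrices.**
With `D = diagonal d` (positive diagonal), `J = D^{1/2}(I-R)D^{1/2}` and
`J' = D^{1/2}(I-R')D^{1/2}`, where `|R'| ≤ |R|` entrywise, `α = ‖R̄‖ < 1` and the powers of
`R` and `R'` agree at `(i,j)` up to power `γ`, both `J` and `J'` are invertible and
`|(J⁻¹)(i,j) - (J'⁻¹)(i,j)| ≤ (α^γ / D_min) · 2α/(1-α)`. -/
theorem stmt_2 {p : ℕ} [NeZero p] (d : Fin p → ℝ) (hd : ∀ i, 0 < d i)
    (R R' : Matrix (Fin p) (Fin p) ℝ) (α : ℝ)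
    (hdom : ∀ i j, |R' i j| ≤ |R i j|)
    (hα : spec (Matrix.of fun i j => |R i j|) = α) (hα1 : α < 1)
    (i j : Fin p) (γ : ℕ)
    (hagree : ∀ k ≤ γ, (R ^ k) i j = (R' ^ k) i j) :
    IsUnit (Matrix.diagonal (fun a => Real.sqrt (d a)) * (1 - R) *
        Matrix.diagonal (fun a => Real.sqrt (d a))) ∧
    IsUnit (Matrix.diagonal (fun a => Real.sqrt (d a)) * (1 - R') *
        Matrix.diagonal (fun a => Real.sqrt (d a))) ∧
    |(Matrix.diagonal (fun a => Real.sqrt (d a)) * (1 - R) *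
        Matrix.diagonal (fun a => Real.sqrt (d a)))⁻¹ i j -
      (Matrix.diagonal (fun a => Real.sqrt (d a)) * (1 - R') *
        Matrix.diagonal (fun a => Real.sqrt (d a)))⁻¹ i j| ≤
      α ^ γ / (Finset.univ.inf' Finset.univ_nonempty d) * (2 * α / (1 - α)) := by
  have hα0 : 0 ≤ α := hα ▸ spec_nonneg _
  set B : Matrix (Fin p) (Fin p) ℝ := Matrix.of fun i j => |R i j|
  have hR : ∀ i j, |R i j| ≤ B i j := fun i j => le_rfl
  have hR' : ∀ i j, |R' i j| ≤ B i j := hdom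
  have hB1 : spec B < 1 := hα ▸ hα1
  have hS := summable_pow_of_abs_le hR hB1
  have hS' := summable_pow_of_abs_le hR' hB1
  have hs : ∀ a, Real.sqrt (d a) ≠ 0 := fun a => (Real.sqrt_pos.2 (hd a)).ne'
  obtain ⟨hU, hinv⟩ := diagonal_mul_mul_diagonal_inv hs hS.one_sub_mul_tsum_pow
  obtain ⟨hU', hinv'⟩ := diagonal_mul_mul_diagonal_inv hs hS'.one_sub_mul_tsum_pow
  refine ⟨hU, hU', ?_⟩
  have happ : ∀ {A : Matrix (Fin p) (Fin p) ℝ}, Summable (fun k : ℕ => A ^ k) →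
      (∑' k, A ^ k) i j = ∑' k, (A ^ k) i j := fun h =>
    (Pi.hasSum.1 (Pi.hasSum.1 h.hasSum i) j).tsum_eq.symm
  have hdiff := abs_tsum_sub_tsum_le hα0 hα1
    (fun k => hα ▸ abs_pow_apply_le_spec_pow hR k i j)
    (fun k => hα ▸ abs_pow_apply_le_spec_pow hR' k i j) hagree
  rw [← happ hS, ← happ hS'] at hdiff
  rw [hinv, hinv']
  set m := Finset.univ.inf' Finset.univ_nonempty d
  have hm0 : 0 < m := (Finset.lt_inf'_iff _).2 fun a _ => hd a
  have hle : ∀ a, Real.sqrt m ≤ Real.sqrt (d a) := fun a =>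
    Real.sqrt_le_sqrt (Finset.inf'_le _ (Finset.mem_univ a))
  have hsm : 0 < Real.sqrt m := Real.sqrt_pos.2 hm0
  have hscale : (Real.sqrt (d i))⁻¹ * (Real.sqrt (d j))⁻¹ ≤ m⁻¹ := by
    rw [← mul_inv]
    refine inv_anti₀ hm0 ?_
    calc m = Real.sqrt m * Real.sqrt m := (Real.mul_self_sqrt hm0.le).symm
      _ ≤ _ := mul_le_mul (hle i) (hle j) hsm.le (Real.sqrt_nonneg _)
  calc _ = (Real.sqrt (d i))⁻¹ * (Real.sqrt (d j))⁻¹ *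
        |(∑' k, R ^ k) i j - (∑' k, R' ^ k) i j| := by
        rw [← abs_of_nonneg (a := (Real.sqrt (d i))⁻¹ * (Real.sqrt (d j))⁻¹) (by positivity),
          ← abs_mul]
        congr 1
        ring
    _ ≤ m⁻¹ * (α ^ γ * (2 * α / (1 - α))) :=
        mul_le_mul hscale hdiff (abs_nonneg _) (inv_nonneg.2 hm0.le)
    _ = _ := by ring
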